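/- Chang's algebra is an infinite one-generated MV-algebra: in the lexicographically ordered abelian group ℤ ×ₗ ℤ with strong unit u = (1,0), consider the MV-algebra Γ(ℤ ×ₗ ℤ, u) on the carrier {p : (0,0) ≤ p ≤ (1,0)} with p ⊕ q = u ⊓ (p + q), ¬p = u − p, zero (0,0). Then this carrier is infinite, and the only subset of it that contains (0,0) and the element (0,1) and is closed under ⊕ and ¬ is the whole carrier (i.e., the algebra is generated by the single element (0,1)). -/

import Mathlib

/-- The strong unit u = (1,0) of the lexicographically ordered group ℤ ×ₗ ℤ. -/
def changUnit : ℤ ×ₗ ℤ := toLex (1, 0)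

theorem changUnit_pos : (0 : ℤ ×ₗ ℤ) < changUnit := by
  have h : (0 : ℤ ×ₗ ℤ) = toLex (0, 0) := rfl
  rw [h, changUnit, Prod.Lex.lt_iff]; left; norm_num

/-- The carrier of Chang's algebra Γ(ℤ ×ₗ ℤ, (1,0)): the interval [0, u]. -/
abbrev Chang : Type := {p : ℤ ×ₗ ℤ // 0 ≤ p ∧ p ≤ changUnit}

/-- The constant 0 of Chang's algebra. -/
def changZero : Chang := ⟨0, le_refl 0, changUnit_pos.le⟩

/-- The generator (0,1) of Chang's algebra. -/
def changGen : Chang :=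
  ⟨toLex (0, 1), by
    constructor
    · have h : (0 : ℤ ×ₗ ℤ) = toLex (0, 0) := rfl
      rw [h, Prod.Lex.le_iff]; right; norm_num
    · rw [changUnit, Prod.Lex.le_iff]; left; norm_num⟩

/-- The truncated sum p ⊕ q = u ⊓ (p + q) of Chang's algebra. -/
def changOplus (p q : Chang) : Chang :=
  ⟨changUnit ⊓ (p.1 + q.1),
    le_inf changUnit_pos.le (add_nonneg p.2.1 q.2.1), inf_le_left⟩

/-- The negation ¬p = u - p of Chang's algebra. -/
def changNeg (p : Chang) : Chang :=
  ⟨changUnit - p.1, sub_nonneg.mpr p.2.2, sub_le_self _ p.2.1⟩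

def changN (n : ℕ) : Chang :=
  ⟨toLex (0, (n : ℤ)), by
    constructor
    · have h : (0 : ℤ ×ₗ ℤ) = toLex (0, 0) := rfl
      rw [h, Prod.Lex.le_iff]; right; simp
    · rw [changUnit, Prod.Lex.le_iff]; left; norm_num⟩

theorem changN_succ (n : ℕ) : changOplus (changN n) changGen = changN (n + 1) := by
  apply Subtype.ext
  have h : (changN n).1 + changGen.1 = (changN (n + 1)).1 := by
    change toLex ((0 : ℤ) + 0, (n : ℤ) + 1) = toLex (0, ((n + 1 : ℕ) : ℤ))
    push_cast
    rfl
  change changUnit ⊓ ((changN n).1 + changGen.1) = _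
  rw [h]
  exact inf_eq_right.mpr (changN (n + 1)).2.2

theorem chang_cases (p : Chang) : ∃ n : ℕ, p = changN n ∨ p = changNeg (changN n) := by
  obtain ⟨p, h0, h1⟩ := p
  obtain ⟨⟨a, b⟩, rfl⟩ := toLex.surjective p
  have h : (0 : ℤ ×ₗ ℤ) = toLex (0, 0) := rfl
  have h0' := h0
  have h1' := h1
  rw [h, Prod.Lex.le_iff] at h0'
  rw [changUnit, Prod.Lex.le_iff] at h1'
  simp only [ofLex_toLex] at h0' h1'
  have hab : (a = 0 ∧ 0 ≤ b) ∨ (a = 1 ∧ b ≤ 0) := by omega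
  rcases hab with ⟨rfl, hb⟩ | ⟨rfl, hb⟩
  · refine ⟨b.toNat, Or.inl (Subtype.ext ?_)⟩
    change toLex ((0 : ℤ), b) = toLex (0, (b.toNat : ℤ))
    rw [Int.toNat_of_nonneg hb]
  · refine ⟨(-b).toNat, Or.inr (Subtype.ext ?_)⟩
    change toLex ((1 : ℤ), b) = toLex ((1 : ℤ) - 0, 0 - ((-b).toNat : ℤ))
    rw [Int.toNat_of_nonneg (by omega)]
    simp

/-- Chang's algebra Γ(ℤ ×ₗ ℤ, (1,0)) is an infinite MV-algebra generated by the
single element (0,1): its carrier is infinite, and the only subset containing 0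
and (0,1) that is closed under ⊕ and ¬ is the whole carrier. -/
theorem chang_infinite_one_generated :
    Infinite Chang ∧
      ∀ S : Set Chang, changZero ∈ S → changGen ∈ S →
        (∀ p ∈ S, ∀ q ∈ S, changOplus p q ∈ S) → (∀ p ∈ S, changNeg p ∈ S) →
        S = Set.univ := by
  refine ⟨Infinite.of_injective changN ?_, ?_⟩
  · intro m n h
    have h2 := congrArg (fun p : Chang => (ofLex p.1).2) h
    change (m : ℤ) = n at h2
    exact_mod_cast h2
  · intro S hz hg ho hn
    have key : ∀ n : ℕ, changN n ∈ S := by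
      intro n
      induction n with
      | zero => exact hz
      | succ k ih => rw [← changN_succ]; exact ho _ ih _ hg
    ext p
    simp only [Set.mem_univ, iff_true]
    obtain ⟨n, rfl | rfl⟩ := chang_cases p
    · exact key n
    · exact hn _ (key n)
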